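/- Assume condition (C). Let t : ℂ → ℂ be a trigonometric polynomial (i.e. t(λ) = P(e^λ) for some Laurent polynomial P ∈ ℂ[X, X⁻¹]) satisfying t(λ+iπ) = (−1)^{N−1} t(λ) for all λ, and let Q be of form (Q2) with (Q(ξ_j^{(0)}), Q(ξ_j^{(0)}+iπ)) ≠ (0,0) for every j = 1,…,N. If t(λ)Q(λ) = −a(λ)Q(λ−η) + d(λ)Q(λ+η) for all λ ∈ ℂ, then t is of t-form and det D_t^{(n)} = 0 for every n = 1,…,N. -/

import Mathlib

open Complex Finset

noncomputable section

/-- Shifted inhomogeneity parameter `ξ_n^{(k)} = ξ_n + (s_n − k) η`, where `σ n = 2 s_n`. -/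
def xik {N : ℕ} (η : ℂ) (σ : Fin N → ℕ) (ξ : Fin N → ℂ) (n : Fin N) (k : ℕ) : ℂ :=
  ξ n + ((σ n : ℂ) / 2 - (k : ℂ)) * η

/-- `a(λ) = ∏ₙ sinh (λ − ξ_n + s_n η)`. -/
def afun {N : ℕ} (η : ℂ) (σ : Fin N → ℕ) (ξ : Fin N → ℂ) (lam : ℂ) : ℂ :=
  ∏ n, Complex.sinh (lam - ξ n + ((σ n : ℂ) / 2) * η)

/-- `d(λ) = ∏ₙ sinh (λ − ξ_n − s_n η)`. -/
def dfun {N : ℕ} (η : ℂ) (σ : Fin N → ℕ) (ξ : Fin N → ℂ) (lam : ℂ) : ℂ :=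
  ∏ n, Complex.sinh (lam - ξ n - ((σ n : ℂ) / 2) * η)

/-- `t` is of t-form: `t(λ) = e^{−(N−1)λ} ∑_{j=0}^{N−1} c_j e^{2jλ}`. -/
def tForm (N : ℕ) (t : ℂ → ℂ) : Prop :=
  ∃ c : Fin N → ℂ, ∀ lam : ℂ,
    t lam = Complex.exp (-((N : ℂ) - 1) * lam) * ∑ j, c j * Complex.exp (2 * ((j : ℕ) : ℂ) * lam)

/-- The `(2s_n+1) × (2s_n+1)` tridiagonal matrix `D_t^{(n)}`. -/
def Dmat {N : ℕ} (η : ℂ) (σ : Fin N → ℕ) (ξ : Fin N → ℂ) (t : ℂ → ℂ) (n : Fin N) :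
    Matrix (Fin (σ n + 1)) (Fin (σ n + 1)) ℂ :=
  Matrix.of fun h k =>
    if (h : ℕ) = (k : ℕ) then t (xik η σ ξ n (h : ℕ))
    else if (k : ℕ) = (h : ℕ) + 1 then afun η σ ξ (xik η σ ξ n (h : ℕ))
    else if (h : ℕ) = (k : ℕ) + 1 then -(dfun η σ ξ (xik η σ ξ n (h : ℕ)))
    else 0

/-- The set `Ξ_i = {ξ_i + kη + k′ iπ : k ∈ {−s_i, …, s_i}, k′ ∈ ℤ}`. -/
def XiSet {N : ℕ} (η : ℂ) (σ : Fin N → ℕ) (ξ : Fin N → ℂ) (i : Fin N) : Set ℂ :=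
  {z : ℂ | ∃ k : ℕ, k ≤ σ i ∧ ∃ k' : ℤ, z = xik η σ ξ i k + (k' : ℂ) * ((Real.pi : ℂ) * Complex.I)}

/-- Condition (C): the sets `Ξ_i` are pairwise disjoint. -/
def CondC {N : ℕ} (η : ℂ) (σ : Fin N → ℕ) (ξ : Fin N → ℂ) : Prop :=
  ∀ i j : Fin N, i ≠ j → XiSet η σ ξ i ∩ XiSet η σ ξ j = ∅

/-- The inhomogeneous term `F_x(λ)`. -/
def Ffun {N : ℕ} (η : ℂ) (σ : Fin N → ℕ) (ξ : Fin N → ℂ) (x lam : ℂ) : ℂ :=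
  2 * Complex.exp (-(((∑ n, σ n : ℕ) : ℂ) + 1) * η / 2) *
    Complex.sinh (lam - x + (∑ j, ∑ h ∈ Finset.Icc 1 (σ j), xik η σ ξ j h)
      + (((∑ n, σ n : ℕ) : ℂ) + 1) * η / 2) *
    ∏ j, ∏ h ∈ Finset.range (σ j + 1), Complex.sinh (lam - xik η σ ξ j h)

/-- `w_ε(λ) = 2 ε (i/2)^{N_s} ∏ₙ ∏_{h=1}^{2s_n−1} sinh(λ − ξ_n^{(h)})`. -/
def wfun {N : ℕ} (η : ℂ) (σ : Fin N → ℕ) (ξ : Fin N → ℂ) (ε lam : ℂ) : ℂ :=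
  2 * ε * (Complex.I / 2) ^ (∑ n, σ n) *
    ∏ n, ∏ h ∈ Finset.Icc 1 (σ n - 1), Complex.sinh (lam - xik η σ ξ n h)

/-- An exponential sum which is `o(e^{nx})` as `x → +∞` has no exponents `≥ n`. -/
theorem coeff_eq_zero_of_tendsto (S : Finset ℤ) (c : ℤ → ℂ) (n : ℤ)
    (h : Filter.Tendsto (fun x : ℝ => exp (-(n : ℂ) * x) * ∑ k ∈ S, c k * exp ((k : ℂ) * x))
      Filter.atTop (nhds 0)) :
    ∀ k ∈ S, n ≤ k → c k = 0 := by
  by_contra! hcon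
  obtain ⟨k₀, hk₀, hnk₀, hck₀⟩ := hcon
  have hne : (S.filter fun k => c k ≠ 0).Nonempty := ⟨k₀, by simp [hk₀, hck₀]⟩
  obtain ⟨m, hm, hmax⟩ := Finset.exists_max_image _ (fun k : ℤ => k) hne
  simp only [Finset.mem_filter] at hm hmax
  have hnm : n ≤ m := hnk₀.trans (hmax k₀ ⟨hk₀, hck₀⟩)
  have hdecay : ∀ j : ℤ, j < 0 →
      Filter.Tendsto (fun x : ℝ => exp ((j : ℂ) * x)) Filter.atTop (nhds 0) := by
    intro j hj
    rw [Complex.tendsto_exp_nhds_zero_iff]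
    have hj' : (j : ℝ) < 0 := by exact_mod_cast hj
    simpa using Filter.tendsto_id.const_mul_atTop_of_neg hj'
  have hlead : Filter.Tendsto (fun x : ℝ => ∑ k ∈ S, c k * exp (((k - m : ℤ) : ℂ) * x))
      Filter.atTop (nhds (∑ k ∈ S, if k = m then c m else 0)) := by
    refine tendsto_finsetSum _ fun k hk => ?_
    by_cases hkm : k = m
    · subst hkm
      simp
    · rw [if_neg hkm]
      by_cases hck : c k = 0
      · simp [hck]
      · have hlt : k - m < 0 := by
          have := hmax k ⟨hk, hck⟩
          omega
        simpa using (hdecay _ hlt).const_mul (c k)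
  rw [Finset.sum_ite_eq' S m, if_pos hm.1] at hlead
  have hbdd : ∃ b : ℂ,
      Filter.Tendsto (fun x : ℝ => exp (((n - m : ℤ) : ℂ) * x)) Filter.atTop (nhds b) := by
    rcases hnm.eq_or_lt with rfl | hlt
    · exact ⟨1, by simp⟩
    · exact ⟨0, hdecay _ (by omega)⟩
  obtain ⟨b, hb⟩ := hbdd
  have hprod := hb.mul h
  rw [mul_zero] at hprod
  refine hm.2 (tendsto_nhds_unique hlead (hprod.congr fun x => ?_))
  rw [← mul_assoc, ← Complex.exp_add, Finset.mul_sum]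
  refine Finset.sum_congr rfl fun k _ => ?_
  rw [mul_left_comm, ← Complex.exp_add]
  congr 2
  push_cast
  ring

theorem tendsto_exp_mul_sinh (b : ℂ) :
    Filter.Tendsto (fun x : ℝ => exp (-(x : ℂ)) * Complex.sinh (x - b)) Filter.atTop
      (nhds (exp (-b) / 2)) := by
  have h : Filter.Tendsto (fun x : ℝ => exp (-2 * (x : ℂ) + b)) Filter.atTop (nhds 0) := by
    rw [Complex.tendsto_exp_nhds_zero_iff]
    have : Filter.Tendsto (fun x : ℝ => -2 * x) Filter.atTop Filter.atBot :=
      Filter.tendsto_id.const_mul_atTop_of_neg (by norm_num)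
    simpa using Filter.tendsto_atBot_add_const_right _ b.re this
  have h2 := (h.const_sub (exp (-b))).div_const 2
  rw [sub_zero] at h2
  refine h2.congr fun x => ?_
  rw [Complex.sinh, mul_div_assoc', mul_sub, ← Complex.exp_add, ← Complex.exp_add]
  rw [show -(x : ℂ) + (x - b) = -b by ring, show -(x : ℂ) + -(x - b) = -2 * x + b by ring]

theorem tendsto_exp_mul_prod_sinh {ι : Type*} [Fintype ι] (b : ι → ℂ) :
    Filter.Tendsto
      (fun x : ℝ => exp (-(Fintype.card ι : ℂ) * x) * ∏ i, Complex.sinh (x - b i)) Filter.atTop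
      (nhds (∏ i, exp (-b i) / 2)) := by
  refine (tendsto_finsetProd Finset.univ fun i _ => tendsto_exp_mul_sinh (b i)).congr fun x => ?_
  rw [Finset.prod_mul_distrib, Finset.prod_const, ← Complex.exp_nat_mul, Finset.card_univ]
  congr 2
  ring

theorem tendsto_exp_mul_prod_sinh_half {ι : Type*} [Fintype ι] (b : ι → ℂ) :
    Filter.Tendsto
      (fun x : ℝ => exp (-(Fintype.card ι : ℂ) * ((x / 2 : ℝ) : ℂ)) *
        ∏ i, Complex.sinh ((x - b i) / 2)) Filter.atTop
      (nhds (∏ i, exp (-(b i / 2)) / 2)) := by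
  refine ((tendsto_exp_mul_prod_sinh fun i => b i / 2).comp
    (Filter.tendsto_id.atTop_div_const (by norm_num : (0 : ℝ) < 2))).congr fun x => ?_
  simp only [Function.comp, id]
  push_cast
  simp only [sub_div]

/-- The leading coefficients on the right-hand side of the TQ-equation cancel at `+∞`. -/
theorem tendsto_exp_mul_of_TQ {N : ℕ} (σ : Fin N → ℕ) (η : ℂ) (ξ : Fin N → ℂ)
    (t : ℂ → ℂ) (μ : Fin (∑ n, σ n) → ℂ) (c : ℂ)
    (heq : ∀ lam : ℂ, t lam * ∏ j, Complex.sinh ((lam - μ j) / 2) =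
      c * (-afun η σ ξ lam * ∏ j, Complex.sinh ((lam - η - μ j) / 2) +
        dfun η σ ξ lam * ∏ j, Complex.sinh ((lam + η - μ j) / 2))) :
    Filter.Tendsto (fun x : ℝ => exp (-(N : ℂ) * x) * t x) Filter.atTop (nhds 0) := by
  have hA := tendsto_exp_mul_prod_sinh fun n => ξ n - (σ n : ℂ) / 2 * η
  have hD := tendsto_exp_mul_prod_sinh fun n => ξ n + (σ n : ℂ) / 2 * η
  have hQ := tendsto_exp_mul_prod_sinh_half μ
  have hQm := tendsto_exp_mul_prod_sinh_half fun j => μ j + η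
  have hQp := tendsto_exp_mul_prod_sinh_half fun j => μ j - η
  have hL : (∏ j, exp (-(μ j / 2)) / 2) ≠ 0 :=
    Finset.prod_ne_zero_iff.mpr fun j _ => div_ne_zero (Complex.exp_ne_zero _) two_ne_zero
  have hlim := ((((hA.mul hQm).neg).add (hD.mul hQp)).const_mul c).div hQ hL
  have key : (-((∏ n, exp (-(ξ n - (σ n : ℂ) / 2 * η)) / 2) * ∏ j, exp (-((μ j + η) / 2)) / 2) +
      (∏ n, exp (-(ξ n + (σ n : ℂ) / 2 * η)) / 2) * ∏ j, exp (-((μ j - η) / 2)) / 2) = 0 := by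
    simp only [Finset.prod_div_distrib, ← Complex.exp_sum]
    rw [neg_add_eq_zero, div_mul_div_comm, div_mul_div_comm, ← Complex.exp_add,
      ← Complex.exp_add]
    congr 2
    simp only [neg_sub, neg_add, sub_div, add_div, Finset.sum_add_distrib, Finset.sum_sub_distrib,
      Finset.sum_neg_distrib, Finset.sum_const, Finset.card_univ, Fintype.card_fin,
      ← Finset.sum_mul, ← Finset.sum_div, nsmul_eq_mul, Nat.cast_sum]
    ring
  rw [key, mul_zero, zero_div] at hlim
  refine hlim.congr' ?_
  filter_upwards [hQ.eventually_ne hL] with x hx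
  rw [Pi.div_apply, div_eq_iff hx]
  have h := heq x
  simp only [afun, dfun] at h
  have ha : ∀ n, (x : ℂ) - (ξ n - (σ n : ℂ) / 2 * η) = x - ξ n + (σ n : ℂ) / 2 * η :=
    fun n => by ring
  have hd : ∀ n, (x : ℂ) - (ξ n + (σ n : ℂ) / 2 * η) = x - ξ n - (σ n : ℂ) / 2 * η :=
    fun n => by ring
  have hm : ∀ j, (x : ℂ) - (μ j + η) = x - η - μ j := fun j => by ring
  have hp : ∀ j, (x : ℂ) - (μ j - η) = x + η - μ j := fun j => by ring
  simp only [ha, hd, hm, hp, Fintype.card_fin]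
  linear_combination
    -(exp (-(N : ℂ) * x) * exp (-((∑ n, σ n : ℕ) : ℂ) * ((x / 2 : ℝ) : ℂ))) * h

theorem afun_neg {N : ℕ} (η : ℂ) (σ : Fin N → ℕ) (ξ : Fin N → ℂ) (lam : ℂ) :
    afun η σ ξ (-lam) = (-1) ^ N * dfun η σ (fun n => -ξ n) lam := by
  have h : ∀ n, Complex.sinh (-lam - ξ n + (σ n : ℂ) / 2 * η) =
      -1 * Complex.sinh (lam - -ξ n - (σ n : ℂ) / 2 * η) := fun n => by
    rw [neg_one_mul, ← Complex.sinh_neg]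
    congr 1
    ring
  simp only [afun, dfun, h, Finset.prod_mul_distrib, Finset.prod_const, Finset.card_univ,
    Fintype.card_fin]

theorem dfun_neg {N : ℕ} (η : ℂ) (σ : Fin N → ℕ) (ξ : Fin N → ℂ) (lam : ℂ) :
    dfun η σ ξ (-lam) = (-1) ^ N * afun η σ (fun n => -ξ n) lam := by
  have h : ∀ n, Complex.sinh (-lam - ξ n - (σ n : ℂ) / 2 * η) =
      -1 * Complex.sinh (lam - -ξ n + (σ n : ℂ) / 2 * η) := fun n => by
    rw [neg_one_mul, ← Complex.sinh_neg]
    congr 1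
    ring
  simp only [afun, dfun, h, Finset.prod_mul_distrib, Finset.prod_const, Finset.card_univ,
    Fintype.card_fin]

/-- The leading coefficients on the right-hand side of the TQ-equation cancel at `-∞`. -/
theorem tendsto_exp_mul_neg_of_TQ {N : ℕ} (σ : Fin N → ℕ) (η : ℂ) (ξ : Fin N → ℂ)
    (t : ℂ → ℂ) (μ : Fin (∑ n, σ n) → ℂ)
    (heq : ∀ lam : ℂ, t lam * ∏ j, Complex.sinh ((lam - μ j) / 2) =
      -afun η σ ξ lam * ∏ j, Complex.sinh ((lam - η - μ j) / 2) +
        dfun η σ ξ lam * ∏ j, Complex.sinh ((lam + η - μ j) / 2)) :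
    Filter.Tendsto (fun x : ℝ => exp (-(N : ℂ) * x) * t (-x)) Filter.atTop (nhds 0) := by
  refine tendsto_exp_mul_of_TQ σ η (fun n => -ξ n) (fun lam => t (-lam)) (fun j => -μ j)
    (-(-1) ^ N) fun lam => ?_
  have hprod : ∀ z w : ℂ, w = -z → ∏ j, Complex.sinh ((z - μ j) / 2) =
      (-1) ^ (∑ n, σ n) * ∏ j, Complex.sinh ((w - -μ j) / 2) := by
    rintro z _ rfl
    have h : ∀ j, Complex.sinh ((z - μ j) / 2) = -1 * Complex.sinh ((-z - -μ j) / 2) := fun j => by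
      rw [neg_one_mul, ← Complex.sinh_neg]
      congr 1
      ring
    simp only [h, Finset.prod_mul_distrib, Finset.prod_const, Finset.card_univ, Fintype.card_fin]
  have h := heq (-lam)
  rw [afun_neg, dfun_neg, hprod (-lam) lam (by ring), hprod (-lam - η) (lam + η) (by ring),
    hprod (-lam + η) (lam - η) (by ring)] at h
  have hs : ((-1 : ℂ)) ^ (∑ n, σ n) ≠ 0 := pow_ne_zero _ (by norm_num)
  apply mul_left_cancel₀ hs
  linear_combination h

theorem tForm_of_TQ {N : ℕ} (hN : 1 ≤ N) (σ : Fin N → ℕ) (η : ℂ) (ξ : Fin N → ℂ)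
    (t : ℂ → ℂ) (P : ℤ →₀ ℂ)
    (htP : ∀ lam : ℂ, t lam = P.sum fun k ck => ck * exp ((k : ℂ) * lam))
    (htper : ∀ lam : ℂ, t (lam + (Real.pi : ℂ) * I) = (-1 : ℂ) ^ (N - 1) * t lam)
    (μ : Fin (∑ n, σ n) → ℂ)
    (heq : ∀ lam : ℂ, t lam * ∏ j, Complex.sinh ((lam - μ j) / 2) =
      -afun η σ ξ lam * ∏ j, Complex.sinh ((lam - η - μ j) / 2) +
        dfun η σ ξ lam * ∏ j, Complex.sinh ((lam + η - μ j) / 2)) :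
    tForm N t := by
  have hup : ∀ k ∈ P.support, (N : ℤ) ≤ k → P k = 0 := by
    refine coeff_eq_zero_of_tendsto _ _ _
      ((tendsto_exp_mul_of_TQ σ η ξ t μ 1 (by simpa using heq)).congr fun x => ?_)
    rw [htP, Finsupp.sum, Int.cast_natCast]
  have hdown : ∀ k ∈ P.support.image (fun k => -k), (N : ℤ) ≤ k → P (-k) = 0 := by
    refine coeff_eq_zero_of_tendsto _ (fun k => P (-k)) _
      ((tendsto_exp_mul_neg_of_TQ σ η ξ t μ heq).congr fun x => ?_)
    rw [htP, Finsupp.sum, Int.cast_natCast, Finset.sum_image fun _ _ _ _ => neg_injective.eq_iff.mp]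
    simp
  have hpar : ∀ k ∈ P.support, P k * ((-1) ^ k - (-1) ^ (N - 1)) = 0 := by
    intro k hk
    refine coeff_eq_zero_of_tendsto P.support (fun k => P k * ((-1) ^ k - (-1) ^ (N - 1))) k
      (tendsto_const_nhds.congr fun x => ?_) k hk le_rfl
    have h := htper x
    rw [htP, htP, Finsupp.sum, Finsupp.sum, ← sub_eq_zero, Finset.mul_sum,
      ← Finset.sum_sub_distrib] at h
    rw [eq_comm, mul_eq_zero, ← h]
    refine Or.inr (Finset.sum_congr rfl fun k _ => ?_)
    rw [mul_add, Complex.exp_add, Complex.exp_int_mul (_ * I), Complex.exp_pi_mul_I]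
    ring
  have hsub : P.support ⊆
      (Finset.univ : Finset (Fin N)).image fun j : Fin N => 2 * ((j : ℕ) : ℤ) - ((N : ℤ) - 1) := by
    intro k hk
    have hPk := Finsupp.mem_support_iff.mp hk
    have h1 : k < N := by
      by_contra! h
      exact hPk (hup k hk h)
    have h2 : -k < N := by
      by_contra! h
      exact hPk (by simpa using hdown (-k) (Finset.mem_image_of_mem _ hk) h)
    have h3 : ((-1 : ℂ)) ^ (k + ((N : ℤ) - 1)) = 1 := by
      have h := sub_eq_zero.mp ((mul_eq_zero.mp (hpar k hk)).resolve_left hPk)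
      have hcast : ((N : ℤ) - 1) = ((N - 1 : ℕ) : ℤ) := by omega
      rw [zpow_add₀ (by norm_num), h, hcast, zpow_natCast, ← mul_pow]
      norm_num
    have h4 : Even (k + ((N : ℤ) - 1)) := by
      by_contra h
      rw [Int.not_even_iff_odd] at h
      rw [h.neg_one_zpow] at h3
      norm_num at h3
    obtain ⟨r, hr⟩ := h4
    refine Finset.mem_image.mpr ⟨⟨r.toNat, by omega⟩, Finset.mem_univ _, ?_⟩
    simp only
    omega
  refine ⟨fun j => P (2 * ((j : ℕ) : ℤ) - ((N : ℤ) - 1)), fun lam => ?_⟩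
  rw [htP, Finsupp.sum_of_support_subset P hsub _ (by simp), Finset.sum_image, Finset.mul_sum]
  · refine Finset.sum_congr rfl fun j _ => ?_
    rw [mul_left_comm, ← Complex.exp_add]
    congr 2
    push_cast
    ring
  · intro i _ j _ hij
    simp only at hij
    exact Fin.ext (by omega)

/-- A tridiagonal matrix whose three-term recursion has a solution with `w 0 ≠ 0` is singular. -/
theorem det_tridiagonal_eq_zero (m : ℕ) (δ α β w : ℕ → ℂ) (hα : α m = 0)
    (hw : w 0 ≠ 0) (h0 : δ 0 * w 0 + α 0 * w 1 = 0)
    (hrec : ∀ h, δ (h + 1) * w (h + 1) + α (h + 1) * w (h + 2) + β (h + 1) * w h = 0) :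
    (Matrix.of fun h k : Fin (m + 1) =>
      if (h : ℕ) = (k : ℕ) then δ h
      else if (k : ℕ) = (h : ℕ) + 1 then α h
      else if (h : ℕ) = (k : ℕ) + 1 then β h
      else 0).det = 0 := by
  refine Matrix.exists_mulVec_eq_zero_iff.mp ⟨fun k => w k, fun h => hw (congrFun h 0), ?_⟩
  ext ⟨h, hh⟩
  simp only [Matrix.mulVec, dotProduct, Matrix.of_apply, Pi.zero_apply]
  have hsplit : ∀ k : ℕ,
      (if h = k then δ h else if k = h + 1 then α h else if h = k + 1 then β h else 0) * w k =
        (if k = h then δ h * w h else 0) + (if k = h + 1 then α h * w (h + 1) else 0) +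
          (if h = k + 1 then β h * w k else 0) := by
    intro k
    split_ifs <;> first | omega | (subst_vars; simp)
  rw [Fin.sum_univ_eq_sum_range (fun k => (if h = k then δ h else if k = h + 1 then α h
    else if h = k + 1 then β h else 0) * w k) (m + 1)]
  simp only [hsplit, Finset.sum_add_distrib, Finset.sum_ite_eq', Finset.mem_range, if_pos hh]
  have hup : (if h + 1 < m + 1 then α h * w (h + 1) else 0) = α h * w (h + 1) := by
    split_ifs with hlt
    · rfl
    · obtain rfl : h = m := by omega
      simp [hα]
  rw [hup]
  cases h with
  | zero => simpa using h0
  | succ h =>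
    simp only [Nat.add_right_cancel_iff, Finset.sum_ite_eq, Finset.mem_range]
    rw [if_pos (by omega)]
    exact hrec h

theorem xik_sub {N : ℕ} (η : ℂ) (σ : Fin N → ℕ) (ξ : Fin N → ℂ) (n : Fin N) (k : ℕ) :
    xik η σ ξ n k - η = xik η σ ξ n (k + 1) := by
  simp only [xik]
  push_cast
  ring

theorem xik_succ_add {N : ℕ} (η : ℂ) (σ : Fin N → ℕ) (ξ : Fin N → ℂ) (n : Fin N) (k : ℕ) :
    xik η σ ξ n (k + 1) + η = xik η σ ξ n k := by
  rw [← xik_sub, sub_add_cancel]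

theorem dfun_xik_zero {N : ℕ} (η : ℂ) (σ : Fin N → ℕ) (ξ : Fin N → ℂ) (n : Fin N) :
    dfun η σ ξ (xik η σ ξ n 0) = 0 := by
  refine Finset.prod_eq_zero (Finset.mem_univ n) ?_
  rw [← Complex.sinh_zero]
  congr 1
  simp [xik]

theorem afun_xik_last {N : ℕ} (η : ℂ) (σ : Fin N → ℕ) (ξ : Fin N → ℂ) (n : Fin N) :
    afun η σ ξ (xik η σ ξ n (σ n)) = 0 := by
  refine Finset.prod_eq_zero (Finset.mem_univ n) ?_
  rw [← Complex.sinh_zero]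
  congr 1
  simp only [xik]
  ring

theorem det_Dmat_eq_zero {N : ℕ} (η : ℂ) (σ : Fin N → ℕ) (ξ : Fin N → ℂ) (t : ℂ → ℂ)
    (n : Fin N) (w : ℕ → ℂ) (hw : w 0 ≠ 0)
    (h0 : t (xik η σ ξ n 0) * w 0 + afun η σ ξ (xik η σ ξ n 0) * w 1 = 0)
    (hrec : ∀ h, t (xik η σ ξ n (h + 1)) * w (h + 1) +
      afun η σ ξ (xik η σ ξ n (h + 1)) * w (h + 2) -
      dfun η σ ξ (xik η σ ξ n (h + 1)) * w h = 0) :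
    (Dmat η σ ξ t n).det = 0 :=
  det_tridiagonal_eq_zero (σ n) (fun h => t (xik η σ ξ n h)) (fun h => afun η σ ξ (xik η σ ξ n h))
    (fun h => -dfun η σ ξ (xik η σ ξ n h)) w (afun_xik_last η σ ξ n) hw
    h0 fun h => by linear_combination hrec h

theorem afun_add_pi_mul_I {N : ℕ} (η : ℂ) (σ : Fin N → ℕ) (ξ : Fin N → ℂ) (lam : ℂ) :
    afun η σ ξ (lam + (Real.pi : ℂ) * I) = (-1) ^ N * afun η σ ξ lam := by
  have h : ∀ n, Complex.sinh (lam + (Real.pi : ℂ) * I - ξ n + (σ n : ℂ) / 2 * η) =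
      -1 * Complex.sinh (lam - ξ n + (σ n : ℂ) / 2 * η) := fun n => by
    rw [neg_one_mul, ← Complex.sinh_add_pi_mul_I]
    congr 1
    ring
  simp only [afun, h, Finset.prod_mul_distrib, Finset.prod_const, Finset.card_univ,
    Fintype.card_fin]

theorem dfun_add_pi_mul_I {N : ℕ} (η : ℂ) (σ : Fin N → ℕ) (ξ : Fin N → ℂ) (lam : ℂ) :
    dfun η σ ξ (lam + (Real.pi : ℂ) * I) = (-1) ^ N * dfun η σ ξ lam := by
  have h : ∀ n, Complex.sinh (lam + (Real.pi : ℂ) * I - ξ n - (σ n : ℂ) / 2 * η) =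
      -1 * Complex.sinh (lam - ξ n - (σ n : ℂ) / 2 * η) := fun n => by
    rw [neg_one_mul, ← Complex.sinh_add_pi_mul_I]
    congr 1
    ring
  simp only [dfun, h, Finset.prod_mul_distrib, Finset.prod_const, Finset.card_univ,
    Fintype.card_fin]

theorem stmt_8 {N : ℕ} (hN : 1 ≤ N) (σ : Fin N → ℕ) (hσ : ∀ n, 1 ≤ σ n)
    (η : ℂ) (hη : ∀ r : ℚ, η ≠ (r : ℂ) * ((Real.pi : ℂ) * Complex.I))
    (ξ : Fin N → ℂ) (hC : CondC η σ ξ)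
    (t : ℂ → ℂ) (P : ℤ →₀ ℂ)
    (htP : ∀ lam : ℂ, t lam = P.sum fun k ck => ck * Complex.exp ((k : ℂ) * lam))
    (htper : ∀ lam : ℂ,
      t (lam + (Real.pi : ℂ) * Complex.I) = (-1 : ℂ) ^ (N - 1) * t lam)
    (Q : ℂ → ℂ) (μ : Fin (∑ n, σ n) → ℂ)
    (hQ : ∀ lam : ℂ, Q lam = ∏ j, Complex.sinh ((lam - μ j) / 2))
    (hadm : ∀ j : Fin N,
      (Q (xik η σ ξ j 0), Q (xik η σ ξ j 0 + (Real.pi : ℂ) * Complex.I)) ≠ (0, 0))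
    (heq : ∀ lam : ℂ, t lam * Q lam =
      -afun η σ ξ lam * Q (lam - η) + dfun η σ ξ lam * Q (lam + η)) :
    tForm N t ∧ ∀ n : Fin N, (Dmat η σ ξ t n).det = 0 := by
  constructor
  · refine tForm_of_TQ hN σ η ξ t P htP htper μ fun lam => ?_
    simpa only [hQ] using heq lam
  intro n
  by_cases hq : Q (xik η σ ξ n 0) = 0
  · have hq' : Q (xik η σ ξ n 0 + (Real.pi : ℂ) * Complex.I) ≠ 0 := fun h =>
      hadm n (by rw [hq, h])
    have hshift : ∀ lam : ℂ, t lam * Q (lam + (Real.pi : ℂ) * Complex.I) =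
        afun η σ ξ lam * Q (lam - η + (Real.pi : ℂ) * Complex.I) -
          dfun η σ ξ lam * Q (lam + η + (Real.pi : ℂ) * Complex.I) := by
      intro lam
      have h := heq (lam + (Real.pi : ℂ) * Complex.I)
      obtain ⟨M, rfl⟩ : ∃ M, N = M + 1 := ⟨N - 1, by omega⟩
      rw [htper, afun_add_pi_mul_I, dfun_add_pi_mul_I, Nat.add_sub_cancel, pow_succ,
        add_sub_right_comm, add_right_comm lam _ η] at h
      apply mul_left_cancel₀ (pow_ne_zero M (by norm_num : (-1 : ℂ) ≠ 0))
      linear_combination h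
    refine det_Dmat_eq_zero η σ ξ t n
      (fun h => (-1) ^ h * Q (xik η σ ξ n h + (Real.pi : ℂ) * Complex.I)) (by simpa using hq') ?_ ?_
    · have h := hshift (xik η σ ξ n 0)
      rw [dfun_xik_zero, xik_sub] at h
      linear_combination h
    · intro k
      have h := hshift (xik η σ ξ n (k + 1))
      rw [xik_sub, xik_succ_add] at h
      linear_combination (-1) ^ (k + 1) * h
  · refine det_Dmat_eq_zero η σ ξ t n (fun h => Q (xik η σ ξ n h)) hq ?_ ?_
    · have h := heq (xik η σ ξ n 0)
      rw [dfun_xik_zero, xik_sub] at h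
      linear_combination h
    · intro k
      have h := heq (xik η σ ξ n (k + 1))
      rw [xik_sub, xik_succ_add] at h
      linear_combination h
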